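/- For d = 4, b = 1 (the pushforward of O_{ℙ²}(1) under the 4-uple embedding): dim K_{p,0}(ℙ²,1;4) for p = 0, 1, 2 equals 3, 24, 55 respectively; dim K_{p,1}(ℙ²,1;4) for p = 2,…,11 equals 120, 1089, 3344, 6237, 7920, 7095, 4488, 1947, 536, 75 respectively; dim K_{12,2}(ℙ²,1;4) = 1; and K_{p,q}(ℙ²,1;4) = 0 for all other pairs (p,q) with p ≥ 0 and q ∈ ℤ. -/

import Mathlib

open scoped TensorProduct

set_option maxHeartbeats 2000000
set_option synthInstance.maxHeartbeats 1000000

noncomputable section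

/-- The dimension (over `ℂ`) of a complex vector space, as a natural number. -/
def cdim (M : Type*) [AddCommMonoid M] [Module ℂ M] : ℕ := (Module.rank ℂ M).toNat

/-- The polynomial ring `S = ℂ[x₀,…,x_{N-1}]`. -/
abbrev PolyC (N : ℕ) : Type := MvPolynomial (Fin N) ℂ

/-- The space `S_e` of homogeneous polynomials of degree `e` (zero for `e < 0`). -/
def Sdeg (N : ℕ) (e : ℤ) : Submodule ℂ (PolyC N) :=
  if 0 ≤ e then MvPolynomial.homogeneousSubmodule (Fin N) ℂ e.toNat else ⊥

/-- The monomial `x^σ`. -/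
def monoC (N : ℕ) (σ : Fin N →₀ ℕ) : PolyC N := MvPolynomial.monomial σ (1 : ℂ)

/-- The wedge product `m₁ ∧ ⋯ ∧ mₙ` as an element of the `n`-th exterior power. -/
def wedgeE (R : Type*) [CommRing R] (M : Type*) [AddCommGroup M] [Module R M]
    (n : ℕ) (m : Fin n → M) : ↥(⋀[R]^n M) :=
  ⟨ExteriorAlgebra.ιMulti R n m, ExteriorAlgebra.ιMulti_range R n ⟨m, rfl⟩⟩

/-- The module `⋀^p S_d ⊗ S_e`. -/
abbrev KosModule (N : ℕ) (d : ℤ) (p : ℕ) (e : ℤ) : Type :=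
  (↥(⋀[ℂ]^p ↥(Sdeg N d))) ⊗[ℂ] ↥(Sdeg N e)

/-- `D` satisfies the defining formula of the Koszul differential
`∂_{p+1} : ⋀^{p+1} S_d ⊗ S_e → ⋀^p S_d ⊗ S_{e'}` (for `e' = e + d`), namely
`∂(m₁∧⋯∧m_{p+1} ⊗ f) = ∑ₖ (−1)ᵏ m₁∧⋯∧m̂ₖ∧⋯∧m_{p+1} ⊗ (mₖ·f)`; the equality is
stated after applying the (injective) inclusion `⋀^p S_d ⊗ S_{e'} → ⋀^p S_d ⊗ S`. -/
def IsKoszulDiff (N : ℕ) (d e e' : ℤ) (p : ℕ)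
    (D : KosModule N d (p + 1) e →ₗ[ℂ] KosModule N d p e') : Prop :=
  ∀ (m : Fin (p + 1) → ↥(Sdeg N d)) (f : ↥(Sdeg N e)),
    TensorProduct.map (LinearMap.id (R := ℂ) (M := ↥(⋀[ℂ]^p ↥(Sdeg N d)))) (Sdeg N e').subtype
        (D (wedgeE ℂ ↥(Sdeg N d) (p + 1) m ⊗ₜ[ℂ] f)) =
      ∑ k : Fin (p + 1), ((-1 : ℂ) ^ ((k : ℕ) + 1)) •
        (wedgeE ℂ ↥(Sdeg N d) p (fun i => m (Fin.succAbove k i)) ⊗ₜ[ℂ]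
          ((m k : PolyC N) * (f : PolyC N)))

/-- A family of maps of the shape of the Koszul differentials. -/
def KFam (N : ℕ) (d : ℤ) : Type :=
  ∀ (p : ℕ) (e e' : ℤ), KosModule N d (p + 1) e →ₗ[ℂ] KosModule N d p e'

/-- The family `D` consists of the Koszul differentials (at all meaningful degrees). -/
def IsKoszulFam (N : ℕ) (d : ℤ) (D : KFam N d) : Prop :=
  ∀ (p : ℕ) (e e' : ℤ), e' = e + d → IsKoszulDiff N d e e' p (D p e e')

/-- `dim K_{p,q}(ℙ^{N-1}, b; d)`: the dimension of the homology `ker ∂_p / im ∂_{p+1}` at the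
middle term of `⋀^{p+1} S_d ⊗ S_{b+(q-1)d} → ⋀^p S_d ⊗ S_{b+qd} → ⋀^{p-1} S_d ⊗ S_{b+(q+1)d}`,
where for `p = 0` the right-hand map is the zero map (the dimension of the quotient is expressed
as `dim ker − dim (im ⊓ ker)`, which agrees with it since all spaces here are
finite-dimensional). -/
def Kdim (N : ℕ) (d : ℤ) (D : KFam N d) (b : ℤ) : ℕ → ℤ → ℕ
  | 0, q =>
      cdim (KosModule N d 0 (b + q * d)) -
        cdim ↥(LinearMap.range (D 0 (b + (q - 1) * d) (b + q * d)))
  | p + 1, q =>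
      cdim ↥(LinearMap.ker (D p (b + q * d) (b + (q + 1) * d))) -
        cdim
          ↥(LinearMap.range (D (p + 1) (b + (q - 1) * d) (b + q * d)) ⊓
            LinearMap.ker (D p (b + q * d) (b + (q + 1) * d)))

/-- The multidegree-`a` component of `⋀^p S_d ⊗ S_e`: the span of the pure tensors
`m₁∧⋯∧m_p ⊗ f` with the `mᵢ` and `f` monomials of total multidegree `a`. -/
def KComp (N : ℕ) (d : ℤ) (p : ℕ) (e : ℤ) (a : Fin N →₀ ℕ) :
    Submodule ℂ (KosModule N d p e) :=
  Submodule.span ℂ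
    { x | ∃ (σ : Fin p → (Fin N →₀ ℕ)) (τ : Fin N →₀ ℕ)
        (hσ : ∀ i, monoC N (σ i) ∈ Sdeg N d) (hτ : monoC N τ ∈ Sdeg N e),
        (∑ i, σ i) + τ = a ∧
        x = wedgeE ℂ ↥(Sdeg N d) p (fun i => (⟨monoC N (σ i), hσ i⟩ : ↥(Sdeg N d))) ⊗ₜ[ℂ]
            (⟨monoC N τ, hτ⟩ : ↥(Sdeg N e)) }

/-- `dim K_{p,q}(ℙ^{N-1}, b; d)_a`: the dimension of the multidegree-`a` component of the
homology, i.e. of `(ker ∂_p ∩ (⋀^p S_d ⊗ S_{b+qd})_a) / (im ∂_{p+1} ∩ (⋀^p S_d ⊗ S_{b+qd})_a)`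
(again expressed as a difference of dimensions). -/
def KdimA (N : ℕ) (d : ℤ) (D : KFam N d) (b : ℤ) : ℕ → ℤ → (Fin N →₀ ℕ) → ℕ
  | 0, q, a =>
      cdim ↥(KComp N d 0 (b + q * d) a) -
        cdim
          ↥(LinearMap.range (D 0 (b + (q - 1) * d) (b + q * d)) ⊓ KComp N d 0 (b + q * d) a)
  | p + 1, q, a =>
      cdim
        ↥(LinearMap.ker (D p (b + q * d) (b + (q + 1) * d)) ⊓ KComp N d (p + 1) (b + q * d) a) -
        cdim
          ↥(LinearMap.range (D (p + 1) (b + (q - 1) * d) (b + q * d)) ⊓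
            (LinearMap.ker (D p (b + q * d) (b + (q + 1) * d)) ⊓
              KComp N d (p + 1) (b + q * d) a))

/-- Build a multidegree in `Fin 3 →₀ ℕ` from three exponents. -/
def mdeg3 (i j k : ℕ) : Fin 3 →₀ ℕ := Finsupp.equivFunOnFinite.symm ![i, j, k]

end


set_option linter.all false

/-! ### Part A: a combinatorial model of the Koszul complex -/

namespace VB

/-- Exponent vectors. -/
abbrev Ex : Type := Fin 3 →₀ ℕ

section model

variable {J : Type} [LinearOrder J]

/-- The combinatorial Koszul complex: basis of pairs (finite set of variables, monomial). -/
abbrev TT (J : Type) : Type := (Finset J × Ex) →₀ ℂ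

/-- The sign of `k` in `I`. -/
noncomputable def sg (k : J) (I : Finset J) : ℂ := (-1) ^ (I.filter (· < k)).card

lemma sg_mul_self (k : J) (I : Finset J) : sg k I * sg k I = 1 := by
  unfold sg
  rw [← mul_pow]; simp

lemma sg_erase_self (k : J) (I : Finset J) : sg k (I.erase k) = sg k I := by
  unfold sg
  congr 2
  ext x
  simp only [Finset.mem_filter, Finset.mem_erase]
  constructor
  · rintro ⟨⟨_, h⟩, h'⟩; exact ⟨h, h'⟩
  · rintro ⟨h, h'⟩; exact ⟨⟨ne_of_lt h', h⟩, h'⟩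

lemma sg_insert_self (k : J) (I : Finset J) : sg k (insert k I) = sg k I := by
  unfold sg
  congr 2
  ext x
  simp only [Finset.mem_filter, Finset.mem_insert]
  constructor
  · rintro ⟨h | h, h'⟩
    · exact absurd h (ne_of_lt h')
    · exact ⟨h, h'⟩
  · rintro ⟨h, h'⟩; exact ⟨Or.inr h, h'⟩

lemma sg_erase (k l : J) (I : Finset J) (hk : k ∈ I) :
    sg l I = sg l (I.erase k) * (if k < l then -1 else 1) := by
  unfold sg
  rw [Finset.filter_erase]
  split_ifs with h
  · rw [← pow_succ, Finset.card_erase_add_one]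
    simp [hk, h]
  · rw [Finset.erase_eq_of_notMem]
    · simp
    · simp [h]

lemma sg_anti (k l : J) (I : Finset J) (hk : k ∈ I) (hl : l ∈ I) (hkl : k ≠ l) :
    sg k I * sg l (I.erase k) = - (sg l I * sg k (I.erase l)) := by
  rw [sg_erase k l I hk, sg_erase l k I hl]
  rcases lt_or_gt_of_ne hkl with h | h
  · rw [if_pos h, if_neg (not_lt.mpr h.le)]; ring
  · rw [if_pos h, if_neg (not_lt.mpr h.le)]; ring

variable (w : J → Ex)

/-- The differential on a basis element. -/
noncomputable def dB (a : Finset J × Ex) : TT J :=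
  ∑ k ∈ a.1, Finsupp.single (a.1.erase k, w k + a.2) (sg k a.1)

/-- The differential. -/
noncomputable def dT : TT J →ₗ[ℂ] TT J := Finsupp.linearCombination ℂ (dB w)

lemma dT_single (a : Finset J × Ex) : dT w (Finsupp.single a 1) = dB w a := by
  simp [dT]

lemma dT_single' (a : Finset J × Ex) (c : ℂ) : dT w (Finsupp.single a c) = c • dB w a := by
  simp [dT]

lemma dT_dT (x : TT J) : dT w (dT w x) = 0 := by
  suffices h : (dT w).comp (dT w) = 0 by
    exact LinearMap.congr_fun h x
  apply Finsupp.lhom_ext'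
  intro a
  ext1
  simp only [LinearMap.comp_apply, Finsupp.lsingle_apply, LinearMap.zero_apply, dT_single]
  obtain ⟨I, τ⟩ := a
  unfold dB
  simp only [map_sum, dT_single']
  unfold dB
  simp only [Finset.smul_sum, Finsupp.smul_single, smul_eq_mul]
  set F : J → J → TT J := fun k l =>
    if k = l then 0 else
    Finsupp.single ((I.erase k).erase l, w l + (w k + τ)) (sg k I * sg l (I.erase k)) with hF
  have h1 : ∀ k ∈ I, ∑ l ∈ I.erase k, Finsupp.single ((I.erase k).erase l, w l + (w k + τ))
      (sg k I * sg l (I.erase k)) = ∑ l ∈ I, F k l := by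
    intro k hk
    rw [← Finset.add_sum_erase I _ hk]
    simp only [hF, if_true, zero_add]
    apply Finset.sum_congr rfl
    intro l hl
    rw [if_neg (Finset.ne_of_mem_erase hl).symm]
  rw [Finset.sum_congr rfl h1]
  have h2 : ∑ k ∈ I, ∑ l ∈ I, F k l = - ∑ k ∈ I, ∑ l ∈ I, F k l := by
    conv_lhs => rw [Finset.sum_comm]
    rw [← Finset.sum_neg_distrib]
    apply Finset.sum_congr rfl
    intro k hk
    rw [← Finset.sum_neg_distrib]
    apply Finset.sum_congr rfl
    intro l hl
    simp only [hF]
    by_cases hkl : k = l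
    · simp [hkl]
    · rw [if_neg hkl, if_neg (Ne.symm hkl), ← Finsupp.single_neg, sg_anti k l I hk hl hkl, neg_neg,
        Finset.erase_right_comm, add_left_comm]
  have h3 : (2 : ℂ) • ∑ k ∈ I, ∑ l ∈ I, F k l = 0 := by
    rw [two_smul]
    nth_rewrite 2 [h2]
    simp
  exact (smul_eq_zero.mp h3).resolve_left two_ne_zero

/-- Supported elements. -/
abbrev Sup (s : Set (Finset J × Ex)) : Submodule ℂ (TT J) := Finsupp.supported ℂ ℂ s

lemma sup_induct {s : Set (Finset J × Ex)} {M : Type*} [AddCommGroup M] [Module ℂ M]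
    (f : TT J →ₗ[ℂ] M) (W : Submodule ℂ M)
    (h : ∀ a ∈ s, f (Finsupp.single a 1) ∈ W) {v : TT J} (hv : v ∈ Sup s) : f v ∈ W := by
  have : Sup s ≤ W.comap f := by
    rw [Sup, Finsupp.supported_eq_span_single, Submodule.span_le]
    rintro _ ⟨a, ha, rfl⟩
    exact h a ha
  exact this hv

/-- The homotopy attached to a distinguished variable `y` with weight `4 e_i`. -/
noncomputable def hB (y : J) (i : Fin 3) (a : Finset J × Ex) : TT J :=
  if y ∈ a.1 ∨ a.2 i < 4 then 0 else
    Finsupp.single (insert y a.1, a.2 - Finsupp.single i 4) (sg y a.1)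

/-- The homotopy. -/
noncomputable def hT (y : J) (i : Fin 3) : TT J →ₗ[ℂ] TT J := Finsupp.linearCombination ℂ (hB y i)

lemma hT_single (y : J) (i : Fin 3) (a : Finset J × Ex) (c : ℂ) :
    hT y i (Finsupp.single a c) = c • hB y i a := by
  simp [hT]

lemma ex_add_sub (τ : Ex) (i : Fin 3) : Finsupp.single i 4 + τ - Finsupp.single i 4 = τ := by
  ext j; simp

lemma ex_sub_add (σ τ : Ex) (i : Fin 3) (h : 4 ≤ τ i) :
    σ + τ - Finsupp.single i 4 = σ + (τ - Finsupp.single i 4) := by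
  ext j
  by_cases hj : i = j
  · subst hj; simp; omega
  · simp [Finsupp.single_apply, hj]

lemma ex_sub_add' (τ : Ex) (i : Fin 3) (h : 4 ≤ τ i) :
    Finsupp.single i 4 + (τ - Finsupp.single i 4) = τ := by
  ext j
  by_cases hj : i = j
  · subst hj; simp; omega
  · simp [Finsupp.single_apply, hj]

lemma homotopy (y : J) (i : Fin 3) (hy : w y = Finsupp.single i 4) (a : Finset J × Ex)
    (ha : y ∈ a.1 ∨ 4 ≤ a.2 i) :
    dT w (hT y i (Finsupp.single a 1)) + hT y i (dT w (Finsupp.single a 1)) =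
      Finsupp.single a 1 := by
  obtain ⟨I, τ⟩ := a
  simp only at ha
  simp only [dT_single, hT_single, one_smul]
  by_cases hyI : y ∈ I
  · have h0 : hB y i (I, τ) = 0 := by simp [hB, hyI]
    rw [h0, map_zero, zero_add]
    unfold dB
    simp only [map_sum, hT_single]
    rw [Finset.sum_eq_single_of_mem y hyI]
    · rw [hy]
      have : ¬ (y ∈ I.erase y ∨ ((Finsupp.single i 4 + τ : Ex) i) < 4) := by simp
      unfold hB
      simp only
      rw [if_neg this, Finset.insert_erase hyI, ex_add_sub, sg_erase_self]
      simp [sg_mul_self]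
    · intro k hk hky
      have : y ∈ I.erase k := Finset.mem_erase.mpr ⟨hky.symm, hyI⟩
      simp [hB, this]
  · have h4 : 4 ≤ τ i := ha.resolve_left hyI
    have h0 : hB y i (I, τ) =
        Finsupp.single (insert y I, τ - Finsupp.single i 4) (sg y I) := by
      unfold hB
      simp only
      rw [if_neg]
      push Not
      exact ⟨hyI, h4⟩
    rw [h0, dT_single']
    unfold dB
    simp only [map_sum, hT_single]
    rw [Finset.sum_insert hyI, smul_add, Finset.erase_insert hyI, hy, ex_sub_add' _ _ h4,
      sg_insert_self, Finsupp.smul_single, smul_eq_mul, sg_mul_self, add_assoc]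
    convert add_zero _
    rw [Finset.smul_sum, ← Finset.sum_add_distrib]
    apply Finset.sum_eq_zero
    intro k hk
    have hky : k ≠ y := fun h => hyI (h ▸ hk)
    have h1 : hB y i (I.erase k, w k + τ) = Finsupp.single
        ((insert y I).erase k, w k + (τ - Finsupp.single i 4)) (sg y (I.erase k)) := by
      unfold hB
      simp only
      rw [if_neg, ex_sub_add _ _ _ h4, Finset.erase_insert_of_ne hky.symm]
      push Not
      refine ⟨fun h => hyI (Finset.mem_of_mem_erase h), ?_⟩
      simp; omega
    rw [h1, Finsupp.smul_single, Finsupp.smul_single, ← Finsupp.single_add, smul_eq_mul,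
      smul_eq_mul]
    have h2 := sg_anti k y (insert y I) (Finset.mem_insert_of_mem hk) (Finset.mem_insert_self _ _) hky
    rw [Finset.erase_insert hyI, sg_insert_self] at h2
    have h3 : sg y ((insert y I).erase k) = sg y (I.erase k) := by
      rw [Finset.erase_insert_of_ne hky.symm, sg_insert_self]
    have h4' : sg k I * sg k I = 1 := sg_mul_self _ _
    rw [h3] at h2
    have e1 := sg_erase y k (insert y I) (Finset.mem_insert_self _ _)
    have e2 := sg_erase k y I hk
    rw [Finset.erase_insert hyI] at e1
    rw [e1, e2]
    rcases lt_or_gt_of_ne hky with h | h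
    · rw [if_pos h, if_neg (not_lt.mpr h.le)]; ring_nf; simp
    · rw [if_pos h, if_neg (not_lt.mpr h.le)]; ring_nf; simp

variable (y : Fin 3 → J)

/-- Bad basis elements with respect to `Y`. -/
noncomputable def bad (Y : Set (Fin 3)) : Set (Finset J × Ex) := {a | ∃ i ∈ Y, y i ∈ a.1 ∨ 4 ≤ a.2 i}

lemma sup_d {s s' : Set (Finset J × Ex)}
    (h : ∀ a ∈ s, ∀ k ∈ a.1, (a.1.erase k, w k + a.2) ∈ s') {v : TT J} (hv : v ∈ Sup s) :
    dT w v ∈ Sup s' := by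
  refine sup_induct (dT w) _ ?_ hv
  intro a ha
  rw [dT_single]
  exact Submodule.sum_mem _ fun k hk => Finsupp.single_mem_supported _ _ (h a ha k hk)

lemma sup_h {s s' : Set (Finset J × Ex)} (z : J) (i : Fin 3)
    (h : ∀ a ∈ s, z ∉ a.1 → 4 ≤ a.2 i → (insert z a.1, a.2 - Finsupp.single i 4) ∈ s') {v : TT J}
    (hv : v ∈ Sup s) :
    hT z i v ∈ Sup s' := by
  refine sup_induct (hT z i) _ ?_ hv
  intro a ha
  rw [hT_single, one_smul]
  unfold hB
  split_ifs with h1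
  · exact Submodule.zero_mem _
  · push Not at h1
    exact Finsupp.single_mem_supported _ _ (h a ha h1.1 h1.2)

lemma bad_d (hy : ∀ i, w (y i) = Finsupp.single i 4) (Y : Set (Fin 3)) {v : TT J} (hv : v ∈ Sup (bad y Y)) : dT w v ∈ Sup (bad y Y) := by
  refine sup_d w ?_ hv
  rintro ⟨I, τ⟩ ⟨i, hi, h⟩ k hk
  refine ⟨i, hi, ?_⟩
  simp only at h hk ⊢
  rcases h with h | h
  · by_cases hki : k = y i
    · right; subst hki; simp [hy]
    · left; exact Finset.mem_erase.mpr ⟨fun h' => hki h'.symm, h⟩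
  · right; simp; omega

lemma bad_h (Y : Set (Fin 3)) (i : Fin 3) (hi : i ∉ Y) {v : TT J} (hv : v ∈ Sup (bad y Y)) :
    hT (y i) i v ∈ Sup (bad y Y) := by
  refine sup_h (y i) i ?_ hv
  rintro ⟨I, τ⟩ ⟨j, hj, h⟩ _ _
  refine ⟨j, hj, ?_⟩
  have hij : i ≠ j := fun h' => hi (h' ▸ hj)
  rcases h with h | h
  · left; exact Finset.mem_insert_of_mem h
  · right; simpa [Finsupp.single_apply, hij] using h

/-- graded pieces -/
noncomputable def gr (J : Type) (p : ℕ) (e : ℤ) : Set (Finset J × Ex) :=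
  {a | a.1.card = p ∧ (a.2.degree : ℤ) = e}

lemma degree_sub (τ : Ex) (i : Fin 3) (h : 4 ≤ τ i) :
    ((τ - Finsupp.single i 4).degree : ℤ) = τ.degree - 4 := by
  have := congrArg Finsupp.degree (ex_sub_add' τ i h)
  rw [map_add] at this
  simp at this
  omega

lemma gr_d (hw : ∀ k, (w k).degree = 4) {p : ℕ} {e e' : ℤ} (he : e' = e + 4) {v : TT J} (hv : v ∈ Sup (gr J (p + 1) e)) :
    dT w v ∈ Sup (gr J p e') := by
  refine sup_d w ?_ hv
  rintro ⟨I, τ⟩ ⟨h1, h2⟩ k hk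
  simp only at h1 h2 hk
  refine ⟨?_, ?_⟩
  · simp [Finset.card_erase_of_mem hk, h1]
  · simp only [map_add, hw]; push_cast; omega

lemma gr_h {p : ℕ} {e e' : ℤ} (he : e' = e + 4) (z : J) (i : Fin 3) {v : TT J}
    (hv : v ∈ Sup (gr J p e')) : hT z i v ∈ Sup (gr J (p + 1) e) := by
  refine sup_h z i ?_ hv
  rintro ⟨I, τ⟩ ⟨h1, h2⟩ hz h4
  simp only at h1 h2 hz h4
  refine ⟨?_, ?_⟩
  · simp [hz, h1]
  · simp only [degree_sub τ i h4]; omega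

lemma step (hy : ∀ i, w (y i) = Finsupp.single i 4) {p : ℕ} {e e' : ℤ} (he : e' = e + 4) (Y : Set (Fin 3)) (i : Fin 3) (hi : i ∉ Y)
    (t : TT J) (ht : t ∈ Sup (gr J p e')) (hdt : dT w t = 0) (hw : ∀ k, (w k).degree = 4)
    (h : ∃ s ∈ Sup (gr J (p + 1) e), t - dT w s ∈ Sup (bad y (insert i Y))) :
    ∃ s ∈ Sup (gr J (p + 1) e), t - dT w s ∈ Sup (bad y Y) := by
  obtain ⟨s, hs, hts⟩ := h
  set v := t - dT w s with hv
  have hdv : dT w v = 0 := by rw [hv, map_sub, hdt, dT_dT, sub_zero]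
  have hvg : v ∈ Sup (gr J p e') := Submodule.sub_mem _ ht (gr_d w hw he hs)
  refine ⟨s + hT (y i) i v, Submodule.add_mem _ hs (gr_h he _ _ hvg), ?_⟩
  have key : ((LinearMap.id : TT J →ₗ[ℂ] TT J) - (dT w).comp (hT (y i) i) - (hT (y i) i).comp (dT w)) v ∈
      Sup (bad y Y) := by
    refine sup_induct _ _ ?_ hts
    rintro a ⟨j, hj, hja⟩
    by_cases hja' : y i ∈ a.1 ∨ 4 ≤ a.2 i
    · have := homotopy w (y i) i (hy i) a hja'
      convert Submodule.zero_mem _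
      simp only [LinearMap.sub_apply, LinearMap.id_apply, LinearMap.comp_apply]
      rw [← this]
      abel_nf
      rw [this]
      abel
    · have haY : a ∈ bad y Y := by
        rcases hj with rfl | hj
        · exact absurd hja hja'
        · exact ⟨j, hj, hja⟩
      have hs : (Finsupp.single a 1 : TT J) ∈ Sup (bad y Y) :=
        Finsupp.single_mem_supported _ _ haY
      simp only [LinearMap.sub_apply, LinearMap.id_apply, LinearMap.comp_apply]
      exact Submodule.sub_mem _ (Submodule.sub_mem _ hs (bad_d w y hy _ (bad_h y _ i hi hs)))
        (bad_h y _ i hi (bad_d w y hy _ hs))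
  simp only [LinearMap.sub_apply, LinearMap.id_apply, LinearMap.comp_apply, hdv, map_zero,
    sub_zero] at key
  rw [map_add, ← sub_sub]
  exact key

lemma reduce (hy : ∀ i, w (y i) = Finsupp.single i 4) 
    (hw : ∀ k, (w k).degree = 4) {p : ℕ} {e e' : ℤ} (he : e' = e + 4)
    (t : TT J) (ht : t ∈ Sup (gr J p e')) (hdt : dT w t = 0)
    (h : ∃ s ∈ Sup (gr J (p + 1) e), t - dT w s ∈ Sup (bad y Set.univ)) :
    ∃ s ∈ Sup (gr J (p + 1) e), dT w s = t := by
  have e3 : (Set.univ : Set (Fin 3)) = insert 0 (insert 1 (insert 2 ∅)) := by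
    ext i; fin_cases i <;> simp
  rw [e3] at h
  have h2 := step w y hy he _ 0 (by simp) t ht hdt hw h
  have h1 := step w y hy he _ 1 (by simp) t ht hdt hw h2
  obtain ⟨s, hs, h0⟩ := step w y hy he _ 2 (by simp) t ht hdt hw h1
  refine ⟨s, hs, ?_⟩
  have : bad y ∅ = ∅ := by ext; simp [bad]
  rw [this, Sup, Finsupp.supported_empty] at h0
  exact (sub_eq_zero.mp ((Submodule.mem_bot ℂ).mp h0)).symm

end model

end VB

/-! ### Part B: exactness in the combinatorial model -/

namespace VB

/-- Exponents of degree `e`. -/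
abbrev EX (e : ℤ) : Type := {τ : Ex // (τ.degree : ℤ) = e}

noncomputable def EXequiv (n : ℕ) : EX (n : ℤ) ≃ Sym (Fin 3) n :=
  (Equiv.subtypeEquivRight (fun τ => by
    rw [Finsupp.degree_apply]; simp [Finsupp.sum]; norm_cast)).trans (Sym.equivNatSum (Fin 3) n).symm

lemma EX_neg {e : ℤ} (he : e < 0) : IsEmpty (EX e) := ⟨fun τ => by have := τ.2; omega⟩

noncomputable instance (e : ℤ) : Fintype (EX e) := by
  by_cases he : e < 0
  · haveI := EX_neg he
    exact Fintype.ofIsEmpty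
  · have h : e = (e.toNat : ℤ) := by omega
    rw [h]
    exact Fintype.ofEquiv _ (EXequiv e.toNat).symm

lemma card_EX (n : ℕ) : Fintype.card (EX (n : ℤ)) = (n + 2).choose 2 := by
  rw [Fintype.card_congr (EXequiv n), Sym.card_sym_eq_choose]
  simp only [Fintype.card_fin]
  rw [show 3 + n - 1 = n + 2 by omega]
  exact Nat.choose_symm_add

/-- The index type of the monomials of degree 4. -/
def JJ : Type := EX 4

noncomputable instance : Fintype JJ := inferInstanceAs (Fintype (EX 4))

noncomputable instance : LinearOrder JJ :=
  LinearOrder.lift' (fun j : EX 4 => toLex j.1) (fun _ _ h => Subtype.ext h)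

/-- The weight. -/
def ww : JJ → Ex := fun k : EX 4 => k.1

lemma ww_inj {k l : JJ} (h : ww k = ww l) : k = l := Subtype.ext h

/-- Constructor. -/
def mkJ (τ : Ex) (h : (τ.degree : ℤ) = 4) : JJ := (⟨τ, h⟩ : EX 4)

lemma ww_mk (τ : Ex) (h : (τ.degree : ℤ) = 4) : ww (mkJ τ h) = τ := rfl

/-- The pure powers. -/
noncomputable def yy (i : Fin 3) : JJ := mkJ (Finsupp.single i 4) (by simp)

lemma hyy (i : Fin 3) : ww (yy i) = Finsupp.single i 4 := rfl

lemma hww (k : JJ) : (ww k).degree = 4 := by have := Subtype.property (k : EX 4); exact_mod_cast this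

lemma deg3 (τ : Ex) : τ.degree = τ 0 + τ 1 + τ 2 := by
  rw [Finsupp.degree_eq_sum, Fin.sum_univ_three]

lemma yy_inj : Function.Injective yy := by
  intro i j h
  have := congrArg ww h
  exact (Finsupp.single_left_injective (by norm_num : (4 : ℕ) ≠ 0)) this

lemma eq_yy (k : JJ) (i : Fin 3) (h : 4 ≤ ww k i) : k = yy i := by
  have h4 := hww k
  rw [deg3] at h4
  apply ww_inj
  ext j
  rw [hyy]
  fin_cases i <;> fin_cases j <;> simp at h ⊢ <;> omega

/-- Monomials that are not pure powers. -/
noncomputable def JB : Finset JJ := Finset.univ \ Finset.univ.image yy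

lemma mem_JB (k : JJ) : k ∈ JB ↔ ∀ i, yy i ≠ k := by simp [JB]

lemma card_JJ : Fintype.card JJ = 15 := card_EX 4

lemma card_JB : JB.card = 12 := by
  rw [JB, Finset.card_sdiff_of_subset (Finset.subset_univ _), Finset.card_image_of_injective _ yy_inj,
    Finset.card_univ, card_JJ]
  simp

lemma sub_JB {I : Finset JJ} {τ : Ex} (h : (I, τ) ∉ bad yy Set.univ) : I ⊆ JB := by
  intro k hk
  rw [mem_JB]
  rintro i rfl
  exact h ⟨i, trivial, Or.inl hk⟩

lemma lt_of_good {I : Finset JJ} {τ : Ex} (h : (I, τ) ∉ bad yy Set.univ) (i : Fin 3) : τ i < 4 := by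
  by_contra h'
  exact h ⟨i, trivial, Or.inr (by simpa using h')⟩

lemma exact_of_bad {p : ℕ} {e e' : ℤ} (he : e' = e + 4) (hb : gr JJ p e' ⊆ bad yy Set.univ)
    (t : TT JJ) (ht : t ∈ Sup (gr JJ p e')) (hdt : dT ww t = 0) :
    ∃ s ∈ Sup (gr JJ (p + 1) e), dT ww s = t := by
  refine reduce ww yy hyy hww he t ht hdt ⟨0, Submodule.zero_mem _, ?_⟩
  rw [map_zero, sub_zero]
  exact Finsupp.supported_mono hb ht

lemma exact_hi {p : ℕ} {e e' : ℤ} (he : e' = e + 4) (h9 : 10 ≤ e')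
    (t : TT JJ) (ht : t ∈ Sup (gr JJ p e')) (hdt : dT ww t = 0) :
    ∃ s ∈ Sup (gr JJ (p + 1) e), dT ww s = t := by
  refine exact_of_bad he ?_ t ht hdt
  rintro ⟨I, τ⟩ ⟨h1, h2⟩
  by_contra hb
  have h := lt_of_good hb
  have := deg3 τ
  have := h 0
  have := h 1
  have := h 2
  simp only at h2
  omega

lemma exact_13 {p : ℕ} {e e' : ℤ} (he : e' = e + 4) (hp : 13 ≤ p)
    (t : TT JJ) (ht : t ∈ Sup (gr JJ p e')) (hdt : dT ww t = 0) :
    ∃ s ∈ Sup (gr JJ (p + 1) e), dT ww s = t := by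
  refine exact_of_bad he ?_ t ht hdt
  rintro ⟨I, τ⟩ ⟨h1, h2⟩
  by_contra hb
  have := Finset.card_le_card (sub_JB hb)
  rw [card_JB] at this
  simp only at h1
  omega

lemma top_ex {I : Finset JJ} {τ : Ex} (h : (I, τ) ∉ bad yy Set.univ) (hd : (τ.degree : ℤ) = 9) (i : Fin 3) :
    τ i = 3 := by
  have h := lt_of_good h
  have := deg3 τ
  have := h 0
  have := h 1
  have := h 2
  fin_cases i <;> simp <;> omega

lemma JB_le {k : JJ} (hk : k ∈ JB) (i : Fin 3) : ww k i ≤ 3 := by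
  by_contra h
  exact (mem_JB k).mp hk i (eq_yy k i (by omega)).symm

lemma exact_9 {p : ℕ} {e e' : ℤ} (he : e' = e + 4) (h9 : e' = 9) (hp : p ≤ 11)
    (t : TT JJ) (ht : t ∈ Sup (gr JJ p e')) (hdt : dT ww t = 0) :
    ∃ s ∈ Sup (gr JJ (p + 1) e), dT ww s = t := by
  refine reduce ww yy hyy hww he t ht hdt ?_
  have key : (LinearMap.id : TT JJ →ₗ[ℂ] TT JJ) t ∈ (Sup (gr JJ (p + 1) e)).map (dT ww) ⊔ Sup (bad yy Set.univ) := by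
    refine sup_induct _ _ ?_ ht
    rintro ⟨I, τ⟩ ⟨h1, h2⟩
    simp only at h1 h2
    rw [LinearMap.id_apply]
    by_cases hb : (I, τ) ∈ bad yy Set.univ
    · exact Submodule.mem_sup_right (Finsupp.single_mem_supported _ _ hb)
    have hI := sub_JB hb
    have hτ := top_ex hb (by omega)
    obtain ⟨m, hm, hmI⟩ : ∃ m ∈ JB, m ∉ I := by
      by_contra hcon
      push Not at hcon
      have := Finset.card_le_card (show JB ⊆ I from hcon)
      rw [card_JB] at this
      omega
    have hmτ : ww m + (τ - ww m) = τ := by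
      ext i
      have := JB_le hm i
      have := hτ i
      simp; omega
    have hdeg : ((τ - ww m).degree : ℤ) = e := by
      have h := congrArg Finsupp.degree hmτ
      rw [map_add, hww] at h
      omega
    have hs : (Finsupp.single (insert m I, τ - ww m) (sg m I) : TT JJ) ∈
        Sup (gr JJ (p + 1) e) := by
      refine Finsupp.single_mem_supported _ _ ⟨?_, hdeg⟩
      simp [hmI, h1]
    have hd := Submodule.mem_map_of_mem (f := dT ww) hs
    rw [← sub_add_cancel (Finsupp.single (I, τ) (1 : ℂ)) (dT ww (Finsupp.single (insert m I, τ - ww m) (sg m I)))]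
    refine Submodule.add_mem _ ?_ (Submodule.mem_sup_left hd)
    refine Submodule.mem_sup_right ?_
    rw [dT_single']
    unfold dB
    simp only
    rw [Finset.sum_insert hmI, smul_add, Finset.erase_insert hmI, hmτ, sg_insert_self,
      Finsupp.smul_single, smul_eq_mul, sg_mul_self, sub_add_eq_sub_sub, sub_self, zero_sub]
    refine Submodule.neg_mem _ (Submodule.smul_mem _ _ (Submodule.sum_mem _ fun k hk => ?_))
    refine Finsupp.single_mem_supported _ _ ?_
    by_contra hb'
    have hkm : k ≠ m := fun h => hmI (h ▸ hk)
    apply hkm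
    have hh := top_ex hb' (by
      rw [map_add, hww]; push_cast; omega)
    apply ww_inj
    ext i
    have h3 := hh i
    have h4 := DFunLike.congr_fun hmτ i
    rw [hτ i] at h4
    simp at h3 h4
    have := JB_le hm i
    have := hτ i
    omega
  obtain ⟨a, ha, b, hb, hab⟩ := Submodule.mem_sup.mp key
  obtain ⟨s, hs, rfl⟩ := ha
  refine ⟨s, hs, ?_⟩
  rw [LinearMap.id_apply] at hab
  rw [← hab, add_sub_cancel_left]
  exact hb

lemma exact_12_5 {e e' : ℤ} (he : e' = e + 4) (h5 : e' = 5)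
    (t : TT JJ) (ht : t ∈ Sup (gr JJ 12 e')) (hdt : dT ww t = 0) :
    ∃ s ∈ Sup (gr JJ (12 + 1) e), dT ww s = t := by
  refine reduce ww yy hyy hww he t ht hdt ⟨0, Submodule.zero_mem _, ?_⟩
  rw [map_zero, sub_zero, Finsupp.mem_supported']
  rintro ⟨I, τ⟩ hb
  by_cases hg : (I, τ) ∈ gr JJ 12 e'
  swap
  · exact (Finsupp.mem_supported' ℂ _).mp ht _ hg
  obtain ⟨h1, h2⟩ := hg
  simp only at h1 h2
  have hI : I = JB := Finset.eq_of_subset_of_card_le (sub_JB hb) (by rw [card_JB, h1])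
  have hlt := lt_of_good hb
  set top : Ex := Finsupp.equivFunOnFinite.symm (fun _ => 3) with htop
  have htop3 : ∀ i, top i = 3 := fun i => rfl
  set m' : Ex := top - τ with hm'
  have hm'τ : m' + τ = top := by
    ext i; have := hlt i; simp [hm', htop3]; omega
  have hmd : (m'.degree : ℤ) = 4 := by
    have h := congrArg Finsupp.degree hm'τ
    rw [map_add, deg3 top] at h
    simp only [htop3] at h
    omega
  set m : JJ := mkJ m' hmd with hm
  have hwm : ww m = m' := rfl
  have hmJ : m ∈ I := by
    rw [hI, mem_JB]
    intro i hi
    have h := DFunLike.congr_fun (congrArg ww hi) i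
    rw [hyy, hm, ww_mk] at h; simp [hm', htop3] at h
    omega
  set a : Finset JJ × Ex := (I.erase m, top) with ha
  have key : ((Finsupp.lapply a : TT JJ →ₗ[ℂ] ℂ) ∘ₗ dT ww - (sg m I) • (Finsupp.lapply (I, τ) : TT JJ →ₗ[ℂ] ℂ)) t ∈ (⊥ : Submodule ℂ ℂ) := by
    refine sup_induct _ _ ?_ ht
    rintro ⟨I', τ'⟩ ⟨h1', h2'⟩
    simp only at h1' h2'
    rw [Submodule.mem_bot]
    simp only [LinearMap.sub_apply, LinearMap.comp_apply, dT_single, LinearMap.smul_apply,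
      Finsupp.lapply_apply, smul_eq_mul]
    unfold dB
    simp only [Finsupp.finsetSum_apply]
    by_cases hII : (I', τ') = (I, τ)
    · obtain ⟨rfl, rfl⟩ := Prod.mk.inj hII
      rw [Finset.sum_eq_single_of_mem m hmJ]
      · have : (I'.erase m, ww m + τ') = a := by rw [ha, ← hm'τ, hwm]
        rw [this]; simp
      · intro k hk hkm
        rw [Finsupp.single_apply, if_neg]
        intro h
        apply hkm
        have h' := (Prod.mk.inj h).2
        rw [← hm'τ] at h'
        exact ww_inj (add_right_cancel h')
    · rw [Finsupp.single_apply, if_neg hII, mul_zero, sub_zero]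
      apply Finset.sum_eq_zero
      intro k hk
      rw [Finsupp.single_apply, if_neg]
      intro h
      apply hII
      obtain ⟨h3, h4⟩ := Prod.mk.inj h
      have hkJ : k ∈ JB := by
        rw [mem_JB]
        intro i hi
        have h5 := DFunLike.congr_fun h4 i
        rw [← hi, htop3] at h5
        simp [hyy] at h5
        omega
      have hkI : k = m := by
        rw [← hI] at hkJ
        by_contra hkm
        have : k ∈ I.erase m := Finset.mem_erase.mpr ⟨hkm, hkJ⟩
        rw [← h3] at this
        exact Finset.notMem_erase _ _ this
      subst hkI
      have h6 : I' = I := by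
        rw [← Finset.insert_erase hk, h3, Finset.insert_erase hmJ]
      rw [h6]
      rw [← hm'τ] at h4
      rw [add_left_cancel h4]
  rw [Submodule.mem_bot] at key
  simp only [LinearMap.sub_apply, LinearMap.comp_apply, hdt, LinearMap.smul_apply,
      Finsupp.lapply_apply, smul_eq_mul, Finsupp.zero_apply, zero_sub, neg_eq_zero] at key
  refine (mul_eq_zero.mp key).resolve_left ?_
  intro h0
  have := sg_mul_self m I
  rw [h0] at this
  simp at this

/-- there is a divisor of degree 4 -/
lemma exists_div (τ : Ex) (h : 4 ≤ τ.degree) : ∃ m : JJ, ww m ≤ τ := by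
  have h3 := deg3 τ
  let f : Fin 3 → ℕ := ![min 4 (τ 0), min (4 - min 4 (τ 0)) (τ 1),
    4 - min 4 (τ 0) - min (4 - min 4 (τ 0)) (τ 1)]
  refine ⟨mkJ (Finsupp.equivFunOnFinite.symm f) ?_, ?_⟩
  · rw [deg3]
    simp [f]
  · rw [ww_mk]
    intro i
    fin_cases i <;> simp [f] <;> omega

lemma exact_0 {e e' : ℤ} (he : e' = e + 4) (h5 : 4 ≤ e')
    (t : TT JJ) (ht : t ∈ Sup (gr JJ 0 e')) :
    ∃ s ∈ Sup (gr JJ (0 + 1) e), dT ww s = t := by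
  have key : (LinearMap.id : TT JJ →ₗ[ℂ] TT JJ) t ∈ (Sup (gr JJ (0 + 1) e)).map (dT ww) := by
    refine sup_induct _ _ ?_ ht
    rintro ⟨I, τ⟩ ⟨h1, h2⟩
    simp only at h1 h2
    obtain ⟨m, hm⟩ := exists_div τ (by omega)
    have hI : I = ∅ := by simpa using h1
    subst hI
    have hmτ : ww m + (τ - ww m) = τ := add_tsub_cancel_of_le hm
    refine ⟨Finsupp.single ({m}, τ - ww m) 1, ?_, ?_⟩
    · refine Finsupp.single_mem_supported _ _ ⟨by simp, ?_⟩
      have h := congrArg Finsupp.degree hmτ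
      rw [map_add, hww] at h
      simp only
      omega
    · rw [dT_single]
      unfold dB
      simp only [Finset.sum_singleton, Finset.erase_singleton, hmτ, LinearMap.id_apply]
      congr 1
      simp [sg, Finset.filter_singleton]
  obtain ⟨s, hs, h⟩ := key
  exact ⟨s, hs, h⟩

/-- congruence modulo boundaries -/
def rel (m : JJ) (n : Ex) (m' : JJ) (n' : Ex) : Prop :=
  (Finsupp.single ({m}, n) 1 - Finsupp.single ({m'}, n') 1 : TT JJ) ∈
    (Sup (gr JJ 2 1)).map (dT ww)

lemma rel_refl (m : JJ) (n : Ex) : rel m n m n := by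
  unfold rel; rw [sub_self]; exact Submodule.zero_mem _

lemma rel_trans {m : JJ} {n : Ex} {m' : JJ} {n' : Ex} {m'' : JJ} {n'' : Ex}
    (h : rel m n m' n') (h' : rel m' n' m'' n'') : rel m n m'' n'' := by
  unfold rel at *
  have := Submodule.add_mem _ h h'
  rwa [sub_add_sub_cancel] at this

lemma rel_swap (m m' : JJ) (j : Fin 3) :
    rel m' (ww m + Finsupp.single j 1) m (ww m' + Finsupp.single j 1) := by
  by_cases hmm : m = m'
  · subst hmm; exact rel_refl _ _
  have hsg : sg m' {m, m'} = - sg m {m, m'} := by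
    have h := sg_anti m m' {m, m'} (by simp) (by simp) hmm
    have e1 : ({m, m'} : Finset JJ).erase m = {m'} := by
      ext x; simp only [Finset.mem_erase, Finset.mem_insert, Finset.mem_singleton]
      constructor
      · tauto
      · rintro rfl; exact ⟨Ne.symm hmm, Or.inr rfl⟩
    have e2 : ({m, m'} : Finset JJ).erase m' = {m} := by
      ext x; simp only [Finset.mem_erase, Finset.mem_insert, Finset.mem_singleton]
      constructor
      · tauto
      · rintro rfl; exact ⟨hmm, Or.inl rfl⟩
    rw [e1, e2] at h
    simp [sg, Finset.filter_singleton] at h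
    simp only [sg]
    rw [h, neg_neg]
  unfold rel
  refine ⟨sg m {m, m'} • Finsupp.single ({m, m'}, Finsupp.single j 1) 1, ?_, ?_⟩
  · refine Submodule.smul_mem _ _ (Finsupp.single_mem_supported _ _ ⟨?_, by simp⟩)
    simp [hmm]
  · rw [map_smul, dT_single]
    unfold dB
    simp only
    rw [Finset.sum_pair hmm, hsg, smul_add, Finsupp.smul_single, Finsupp.smul_single, smul_eq_mul,
      smul_eq_mul, mul_neg, sg_mul_self, Finsupp.single_neg, ← sub_eq_add_neg]
    have e1 : ({m, m'} : Finset JJ).erase m = {m'} := by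
      ext x; simp only [Finset.mem_erase, Finset.mem_insert, Finset.mem_singleton]
      constructor
      · tauto
      · rintro rfl; exact ⟨Ne.symm hmm, Or.inr rfl⟩
    have e2 : ({m, m'} : Finset JJ).erase m' = {m} := by
      ext x; simp only [Finset.mem_erase, Finset.mem_insert, Finset.mem_singleton]
      constructor
      · tauto
      · rintro rfl; exact ⟨hmm, Or.inl rfl⟩
    rw [e1, e2]

lemma rel_all (N : ℕ) : ∀ (m m' : JJ) (n n' : Ex), (ww m - ww m').degree ≤ N → n.degree = 5 →
    ww m + n = ww m' + n' → rel m n m' n' := by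
  induction N with
  | zero =>
    intro m m' n n' hN hn h
    have h1 := hww m
    have h2 := hww m'
    have hmm : m = m' := by
      apply ww_inj
      rw [deg3] at h1 h2 hN
      simp at hN
      ext i
      fin_cases i <;> simp <;> omega
    subst hmm
    rw [add_left_cancel h]
    exact rel_refl _ _
  | succ N ih =>
    intro m m' n n' hN hn h
    by_cases hmm : m = m'
    · subst hmm
      rw [add_left_cancel h]
      exact rel_refl _ _
    have h1 := hww m
    have h2 := hww m'
    rw [deg3] at h1 h2
    have hi : ∃ i, ww m' i < ww m i := by
      by_contra hcon
      push Not at hcon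
      apply hmm
      apply ww_inj
      have := hcon 0
      have := hcon 1
      have := hcon 2
      ext i
      fin_cases i <;> simp <;> omega
    have hj : ∃ j, ww m j < ww m' j := by
      by_contra hcon
      push Not at hcon
      apply hmm
      apply ww_inj
      have := hcon 0
      have := hcon 1
      have := hcon 2
      ext i
      fin_cases i <;> simp <;> omega
    obtain ⟨i, hi⟩ := hi
    obtain ⟨j, hj⟩ := hj
    have hij : i ≠ j := by rintro rfl; omega
    have hnj : 1 ≤ n j := by
      have := DFunLike.congr_fun h j
      simp at this
      omega
    have e1 : n - Finsupp.single j 1 + Finsupp.single j 1 = n := by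
      ext k
      by_cases hk : j = k
      · subst hk; simp; omega
      · simp [hk]
    have d1 : ((n - Finsupp.single j 1).degree : ℤ) = 4 := by
      have := congrArg Finsupp.degree e1
      rw [map_add, Finsupp.degree_single] at this
      omega
    have e2 : ww m - Finsupp.single i 1 + Finsupp.single i 1 = ww m := by
      ext k
      by_cases hk : i = k
      · subst hk; simp; omega
      · simp [hk]
    have d2 : ((ww m - Finsupp.single i 1 + Finsupp.single j 1).degree : ℤ) = 4 := by
      have := congrArg Finsupp.degree e2
      rw [map_add, Finsupp.degree_single, hww] at this
      rw [map_add, Finsupp.degree_single]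
      omega
    set m2 : JJ := mkJ (n - Finsupp.single j 1) d1 with hm2
    have w2 : ww m2 = n - Finsupp.single j 1 := rfl
    set m1 : JJ := mkJ (ww m - Finsupp.single i 1 + Finsupp.single j 1) d2 with hm1
    have w1 : ww m1 = ww m - Finsupp.single i 1 + Finsupp.single j 1 := rfl
    have r1 := rel_swap m2 m j
    have r2 := rel_swap m1 m2 i
    have e3 : ww m + Finsupp.single j 1 = ww m1 + Finsupp.single i 1 := by
      rw [w1]
      rw [add_right_comm, e2]
    rw [e3] at r1
    rw [w2, e1] at r1
    refine rel_trans r1 (rel_trans r2 (ih m1 m' _ n' ?_ ?_ ?_))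
    · have h5 : (ww m - ww m') = (ww m1 - ww m') + Finsupp.single i 1 := by
        ext k
        rw [w1]
        by_cases hk : i = k
        · subst hk
          simp [hij, hij.symm, Finsupp.single_apply]; omega
        · by_cases hk' : j = k
          · subst hk'; simp [hk]; omega
          · simp [hk, hk']
      have := congrArg Finsupp.degree h5
      rw [map_add, Finsupp.degree_single] at this
      omega
    · simp only [map_add, Finsupp.degree_single, hww]
    · rw [← h, w1, w2]
      calc ww m - Finsupp.single i 1 + Finsupp.single j 1 + (n - Finsupp.single j 1 + Finsupp.single i 1)
          = (ww m - Finsupp.single i 1 + Finsupp.single i 1) + (n - Finsupp.single j 1 + Finsupp.single j 1) := by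
            rw [add_add_add_comm, add_comm (Finsupp.single j 1) (Finsupp.single i 1), add_add_add_comm]
        _ = ww m + n := by rw [e1, e2]

lemma exact_1_5 (t : TT JJ) (ht : t ∈ Sup (gr JJ 1 5)) (hdt : dT ww t = 0) :
    ∃ s ∈ Sup (gr JJ (1 + 1) 1), dT ww s = t := by
  classical
  have hex : ∀ a : Finset JJ × Ex, ∃ m : JJ, 4 ≤ a.2.degree → ww m ≤ a.2 := by
    intro a
    by_cases h : 4 ≤ a.2.degree
    · obtain ⟨m, hm⟩ := exists_div a.2 h
      exact ⟨m, fun _ => hm⟩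
    · exact ⟨yy 0, fun h' => absurd h' h⟩
  choose c hc using hex
  let f : TT JJ →ₗ[ℂ] TT JJ :=
    Finsupp.linearCombination ℂ (fun a => Finsupp.single ({c a}, a.2 - ww (c a)) (1 : ℂ))
  have key : ((LinearMap.id : TT JJ →ₗ[ℂ] TT JJ) - f ∘ₗ dT ww) t ∈ (Sup (gr JJ 2 1)).map (dT ww) := by
    refine sup_induct _ _ ?_ ht
    rintro ⟨I, τ⟩ ⟨h1, h2⟩
    simp only at h1 h2
    obtain ⟨m, rfl⟩ := Finset.card_eq_one.mp h1
    simp only [LinearMap.sub_apply, LinearMap.id_apply, LinearMap.comp_apply, dT_single]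
    unfold dB
    have hs : sg m {m} = 1 := by simp [sg, Finset.filter_singleton]
    simp only [Finset.sum_singleton, Finset.erase_singleton, hs]
    simp only [f, Finsupp.linearCombination_single, one_smul]
    have hle := hc (∅, ww m + τ) (by
      simp only [map_add, hww]; omega)
    refine rel_all _ m _ τ _ le_rfl (by exact_mod_cast h2) ?_
    exact (add_tsub_cancel_of_le hle).symm
  simp only [LinearMap.sub_apply, LinearMap.id_apply, LinearMap.comp_apply, hdt, map_zero,
    sub_zero] at key
  obtain ⟨s, hs, h⟩ := key
  exact ⟨s, hs, h⟩

end VB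

/-! ### Part C: the bridge from the Koszul modules to the combinatorial model -/

namespace VB

lemma mem_Sdeg {e : ℤ} {f : PolyC 3} :
    f ∈ Sdeg 3 e ↔ ∀ τ : Ex, MvPolynomial.coeff τ f ≠ 0 → (τ.degree : ℤ) = e := by
  unfold Sdeg
  split_ifs with he
  · rw [MvPolynomial.mem_homogeneousSubmodule]
    constructor
    · intro h τ hτ
      by_contra hne
      exact hτ (h.coeff_eq_zero (by omega))
    · intro h
      intro τ hτ
      have := h τ hτ
      have h2 : Finsupp.weight (1 : Fin 3 → ℕ) τ = τ.degree := by
        rw [Finsupp.degree_eq_weight_one]; rfl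
      rw [h2]
      omega
  · rw [Submodule.mem_bot]
    constructor
    · rintro rfl τ h
      simp at h
    · intro h
      ext τ
      by_contra hne
      have := h τ (by simpa using hne)
      omega

/-- The monomials in degree `e`. -/
noncomputable def sMono (e : ℤ) (τ : EX e) : Sdeg 3 e :=
  ⟨monoC 3 τ.1, by
    rw [mem_Sdeg]
    intro σ hσ
    rw [monoC, MvPolynomial.coeff_monomial] at hσ
    have : τ.1 = σ := by by_contra h; simp [h] at hσ
    rw [← this]; exact τ.2⟩

lemma sMono_val (e : ℤ) (τ : EX e) : (sMono e τ : PolyC 3) = monoC 3 τ.1 := rfl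

lemma sMono_li (e : ℤ) : LinearIndependent ℂ (sMono e) := by
  apply LinearIndependent.of_comp (Sdeg 3 e).subtype
  have h := (MvPolynomial.basisMonomials (Fin 3) ℂ).linearIndependent.comp
    (fun τ : EX e => τ.1) Subtype.val_injective
  rw [MvPolynomial.coe_basisMonomials] at h
  exact h

lemma sMono_span (e : ℤ) : ⊤ ≤ Submodule.span ℂ (Set.range (sMono e)) := by
  rintro ⟨f, hf⟩ -
  have hf' := mem_Sdeg.mp hf
  have h1 : (⟨f, hf⟩ : Sdeg 3 e) = ∑ τ ∈ f.support.attach,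
      MvPolynomial.coeff τ.1 f • sMono e ⟨τ.1, hf' _ (MvPolynomial.mem_support_iff.mp τ.2)⟩ := by
    apply Subtype.ext
    rw [Submodule.coe_sum]
    simp only [Submodule.coe_smul, sMono_val]
    conv_lhs => rw [f.as_sum]
    rw [← Finset.sum_attach]
    apply Finset.sum_congr rfl
    intro τ _
    rw [monoC, MvPolynomial.smul_monomial, smul_eq_mul, mul_one]
  rw [h1]
  exact Submodule.sum_mem _ fun τ _ => Submodule.smul_mem _ _ (Submodule.subset_span ⟨_, rfl⟩)

/-- The monomial basis. -/
noncomputable def sB (e : ℤ) : Module.Basis (EX e) ℂ (Sdeg 3 e) :=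
  Module.Basis.mk (sMono_li e) (sMono_span e)

lemma sB_apply (e : ℤ) (τ : EX e) : sB e τ = sMono e τ := by simp [sB]

/-- The monomial basis in degree 4, with ordered index. -/
noncomputable def vB : Module.Basis JJ ℂ (Sdeg 3 4) := sB 4

lemma vB_val (k : JJ) : (vB k : PolyC 3) = monoC 3 (ww k) := by
  have := sB_apply 4 k
  exact congrArg Subtype.val this

/-- The basis of the Koszul module. -/
noncomputable def kB (p : ℕ) (e : ℤ) :
    Module.Basis (Set.powersetCard JJ p × EX e) ℂ (KosModule 3 4 p e) :=
  (vB.exteriorPower p).tensorProduct (sB e)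

/-- The ordering of a set. -/
noncomputable def oo {p : ℕ} (s : Set.powersetCard JJ p) : Fin p ↪o JJ :=
  Finset.orderEmbOfFin s.val s.prop

lemma kB_apply (p : ℕ) (e : ℤ) (s : Set.powersetCard JJ p) (τ : EX e) :
    kB p e (s, τ) = wedgeE ℂ (Sdeg 3 4) p (fun i => vB (oo s i)) ⊗ₜ[ℂ] sMono e τ := by
  unfold kB
  rw [Module.Basis.tensorProduct_apply, sB_apply, exteriorPower.basis_apply]
  rfl

/-- Forget the constraints. -/
def fg (p : ℕ) (e : ℤ) (a : Set.powersetCard JJ p × EX e) : Finset JJ × Ex := (a.1.val, a.2.val)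

lemma fg_inj (p : ℕ) (e : ℤ) : Function.Injective (fg p e) := by
  rintro ⟨a, b⟩ ⟨c, d⟩ h
  obtain ⟨h1, h2⟩ := Prod.mk.inj h
  exact Prod.ext (Subtype.ext h1) (Subtype.ext h2)

/-- The embedding into the combinatorial model. -/
noncomputable def io (p : ℕ) (e : ℤ) : KosModule 3 4 p e →ₗ[ℂ] TT JJ :=
  (Finsupp.lmapDomain ℂ ℂ (fg p e)) ∘ₗ (kB p e).repr.toLinearMap

lemma io_kB (p : ℕ) (e : ℤ) (a) : io p e (kB p e a) = Finsupp.single (fg p e a) 1 := by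
  simp [io, Finsupp.mapDomain_single]

lemma io_inj (p : ℕ) (e : ℤ) : Function.Injective (io p e) :=
  (Finsupp.mapDomain_injective (fg_inj p e)).comp (kB p e).repr.injective

lemma io_range (p : ℕ) (e : ℤ) : LinearMap.range (io p e) = Sup (gr JJ p e) := by
  unfold io
  rw [LinearMap.range_comp, LinearEquiv.range, ← Finsupp.supported_univ,
    Finsupp.lmapDomain_supported]
  congr 1
  ext ⟨I, τ⟩
  constructor
  · rintro ⟨⟨a, b⟩, -, h⟩
    obtain ⟨rfl, rfl⟩ := Prod.mk.inj h
    exact ⟨a.2, b.2⟩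
  · rintro ⟨h1, h2⟩
    exact ⟨(⟨I, h1⟩, ⟨τ, h2⟩), trivial, rfl⟩

/-- Remove the `k`-th element. -/
noncomputable def er {p : ℕ} (s : Set.powersetCard JJ (p + 1)) (k : Fin (p + 1)) :
    Set.powersetCard JJ p :=
  ⟨s.val.erase (oo s k), by
    have h1 : s.val.card = p + 1 := s.prop
    have h2 := Finset.card_erase_of_mem (Finset.orderEmbOfFin_mem s.val s.prop k)
    change (s.val.erase (oo s k)).card = p
    unfold oo
    rw [h2, h1]; rfl⟩

lemma oo_er {p : ℕ} (s : Set.powersetCard JJ (p + 1)) (k : Fin (p + 1)) (i : Fin p) :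
    oo (er s k) i = oo s (k.succAbove i) := by
  have h := Finset.orderEmbOfFin_unique (er s k).prop (f := fun i => oo s (k.succAbove i))
    (fun i => by
      change _ ∈ s.val.erase (oo s k)
      rw [Finset.mem_erase]
      refine ⟨?_, Finset.orderEmbOfFin_mem s.val s.prop _⟩
      intro h
      exact Fin.succAbove_ne k i ((oo s).injective h))
    (fun i j hij => (oo s).strictMono (Fin.strictMono_succAbove k hij))
  exact (congrFun h i).symm

lemma sg_oo {p : ℕ} (s : Set.powersetCard JJ p) (k : Fin p) :
    sg (oo s k) s.val = (-1) ^ (k : ℕ) := by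
  unfold sg
  congr 1
  have h : (s.val.filter (· < oo s k)) = (Finset.univ.filter (· < k)).map (oo s).toEmbedding := by
    conv_lhs => rw [← Finset.map_orderEmbOfFin_univ s.val s.prop]
    rw [Finset.filter_map]
    congr 1
    ext i
    simp only [Finset.mem_filter, Finset.mem_univ, true_and, Function.comp]
    exact (oo s).lt_iff_lt
  rw [h, Finset.card_map]
  have h2 : (Finset.univ.filter (· < k)) = Finset.Iio k := by ext i; simp
  rw [h2, Fin.card_Iio]

lemma sum_oo {p : ℕ} (s : Set.powersetCard JJ p) {M : Type*} [AddCommMonoid M] (F : JJ → M) :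
    ∑ k ∈ s.val, F k = ∑ k : Fin p, F (oo s k) := by
  conv_lhs => rw [← Finset.map_orderEmbOfFin_univ s.val s.prop]
  rw [Finset.sum_map]
  rfl

/-- Multiply an exponent by the `k`-th variable. -/
noncomputable def mulE {e e' : ℤ} (he : e' = e + 4) (k : JJ) (τ : EX e) : EX e' :=
  ⟨ww k + τ.1, by have := τ.2; rw [map_add, hww, he]; push_cast; omega⟩

lemma incl_inj (p : ℕ) (e' : ℤ) : Function.Injective
    (TensorProduct.map (LinearMap.id (R := ℂ) (M := ↥(⋀[ℂ]^p ↥(Sdeg 3 4)))) (Sdeg 3 e').subtype) :=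
  Module.Flat.lTensor_preserves_injective_linearMap (M := ↥(⋀[ℂ]^p ↥(Sdeg 3 4)))
    (Sdeg 3 e').subtype (Submodule.injective_subtype _)

lemma D_kB {p : ℕ} {e e' : ℤ} (he : e' = e + 4)
    (D : KosModule 3 4 (p + 1) e →ₗ[ℂ] KosModule 3 4 p e') (hD : IsKoszulDiff 3 4 e e' p D)
    (s : Set.powersetCard JJ (p + 1)) (τ : EX e) :
    D (kB (p + 1) e (s, τ)) =
      ∑ k : Fin (p + 1), ((-1 : ℂ) ^ ((k : ℕ) + 1)) • kB p e' (er s k, mulE he (oo s k) τ) := by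
  apply incl_inj
  rw [kB_apply, hD, map_sum]
  apply Finset.sum_congr rfl
  intro k _
  rw [map_smul, kB_apply, TensorProduct.map_tmul]
  congr 2
  · rw [LinearMap.id_apply]
    congr 1
    funext i
    rw [oo_er]
  · rw [vB_val, Submodule.subtype_apply, sMono_val, sMono_val, monoC, monoC, monoC,
      MvPolynomial.monomial_mul, mul_one]
    rfl

lemma io_D {p : ℕ} {e e' : ℤ} (he : e' = e + 4)
    (D : KosModule 3 4 (p + 1) e →ₗ[ℂ] KosModule 3 4 p e') (hD : IsKoszulDiff 3 4 e e' p D)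
    (x : KosModule 3 4 (p + 1) e) : io p e' (D x) = - dT ww (io (p + 1) e x) := by
  suffices h : (io p e') ∘ₗ D = - (dT ww ∘ₗ io (p + 1) e) from LinearMap.congr_fun h x
  apply (kB (p + 1) e).ext
  rintro ⟨s, τ⟩
  rw [LinearMap.comp_apply, LinearMap.neg_apply, LinearMap.comp_apply, D_kB he D hD, io_kB, dT_single,
    map_sum]
  unfold dB
  change _ = - ∑ k ∈ s.val, _
  rw [sum_oo s, ← Finset.sum_neg_distrib]
  apply Finset.sum_congr rfl
  intro k _
  rw [map_smul, io_kB]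
  change _ = - Finsupp.single _ (sg (oo s k) s.val)
  rw [sg_oo, Finsupp.smul_single, smul_eq_mul, mul_one, pow_succ, mul_neg, mul_one,
    Finsupp.single_neg]
  rfl

instance (p : ℕ) (e : ℤ) : Module.Finite ℂ (KosModule 3 4 p e) :=
  Module.Finite.of_basis (kB p e)

lemma finrank_Kos (p : ℕ) (e : ℤ) :
    Module.finrank ℂ (KosModule 3 4 p e) = (15).choose p * Fintype.card (EX e) := by
  rw [Module.finrank_eq_nat_card_basis (kB p e), Nat.card_prod, Set.powersetCard.card,
    Nat.card_eq_fintype_card, Nat.card_eq_fintype_card, card_JJ]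

/-- `D ∘ D = 0`. -/
lemma D_D {p : ℕ} {e e' e'' : ℤ} (he : e' = e + 4) (he' : e'' = e' + 4)
    (D : KosModule 3 4 (p + 1 + 1) e →ₗ[ℂ] KosModule 3 4 (p + 1) e')
    (hD : IsKoszulDiff 3 4 e e' (p + 1) D)
    (D' : KosModule 3 4 (p + 1) e' →ₗ[ℂ] KosModule 3 4 p e'') (hD' : IsKoszulDiff 3 4 e' e'' p D') :
    LinearMap.range D ≤ LinearMap.ker D' := by
  rintro _ ⟨x, rfl⟩
  rw [LinearMap.mem_ker]
  apply io_inj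
  rw [io_D he' D' hD', io_D he D hD, map_neg, dT_dT, map_zero, neg_zero, neg_zero]

/-- Transfer of exactness. -/
lemma transfer {p : ℕ} {e e' : ℤ} (he : e' = e + 4)
    (D : KosModule 3 4 (p + 1) e →ₗ[ℂ] KosModule 3 4 p e') (hD : IsKoszulDiff 3 4 e e' p D)
    (x : KosModule 3 4 p e')
    (h : ∃ s ∈ Sup (gr JJ (p + 1) e), dT ww s = io p e' x) : x ∈ LinearMap.range D := by
  obtain ⟨s, hs, h⟩ := h
  rw [← io_range] at hs
  obtain ⟨y, rfl⟩ := hs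
  refine ⟨(-1 : ℂ) • y, ?_⟩
  apply io_inj
  rw [io_D he D hD, map_smul, map_smul, h, neg_smul, one_smul, neg_neg]

lemma io_ker {p : ℕ} {e e' : ℤ} (he : e' = e + 4)
    (D : KosModule 3 4 (p + 1) e →ₗ[ℂ] KosModule 3 4 p e') (hD : IsKoszulDiff 3 4 e e' p D)
    (x : KosModule 3 4 (p + 1) e) (hx : x ∈ LinearMap.ker D) : dT ww (io (p + 1) e x) = 0 := by
  have := io_D he D hD x
  rw [LinearMap.mem_ker.mp hx, map_zero] at this
  rw [← neg_eq_zero, ← this]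

lemma io_mem {p : ℕ} {e : ℤ} (x : KosModule 3 4 p e) : io p e x ∈ Sup (gr JJ p e) := by
  rw [← io_range]; exact ⟨x, rfl⟩

end VB

/-! ### Part E: injectivity of the differential on `⋀^p S_4 ⊗ S_1` for `p ≥ 3` -/

namespace VB

/-- Polynomial functions on `m` points of the affine space. -/
abbrev RR (m : ℕ) : Type := MvPolynomial (Fin m × Fin 3) ℂ

/-- Evaluation at the `j`-th generic point. -/
noncomputable def ev {m : ℕ} (j : Fin m) : PolyC 3 →ₐ[ℂ] RR m :=
  MvPolynomial.rename (fun i => (j, i))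

/-- The determinant as a `ℂ`-alternating map. -/
noncomputable def detC (m n : ℕ) : (Fin n → RR m) [⋀^Fin n]→ₗ[ℂ] RR m :=
  { (Matrix.detRowAlternating (n := Fin n) (R := RR m)).toMultilinearMap.restrictScalars ℂ with
    map_eq_zero_of_eq' := (Matrix.detRowAlternating (n := Fin n) (R := RR m)).map_eq_zero_of_eq' }

lemma detC_apply (m n : ℕ) (M : Fin n → Fin n → RR m) : detC m n M = Matrix.det (Matrix.of M) := rfl

/-- Evaluation at several points. -/
noncomputable def evs {m n : ℕ} (c : Fin n → Fin m) : Sdeg 3 4 →ₗ[ℂ] (Fin n → RR m) :=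
  LinearMap.pi fun j => (ev (c j)).toLinearMap ∘ₗ (Sdeg 3 4).subtype

/-- The determinant functional. -/
noncomputable def dl {m n : ℕ} (c : Fin n → Fin m) : ↥(⋀[ℂ]^n ↥(Sdeg 3 4)) →ₗ[ℂ] RR m :=
  exteriorPower.alternatingMapLinearEquiv ((detC m n).compLinearMap (evs c))

lemma dl_wedge {m n : ℕ} (c : Fin n → Fin m) (v : Fin n → Sdeg 3 4) :
    dl c (wedgeE ℂ (Sdeg 3 4) n v) = Matrix.det (Matrix.of fun i j => ev (c j) (v i : PolyC 3)) :=
  exteriorPower.alternatingMapLinearEquiv_apply_ιMulti _ v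

/-- The first functional. -/
noncomputable def Ph {p : ℕ} (j : Fin (p + 1)) :
    (↥(⋀[ℂ]^p ↥(Sdeg 3 4))) ⊗[ℂ] PolyC 3 →ₗ[ℂ] RR (p + 1) :=
  TensorProduct.lift ((LinearMap.mul ℂ (RR (p + 1))).compl₁₂ (dl j.succAbove) (ev j).toLinearMap)

/-- The second functional. -/
noncomputable def Ps {p : ℕ} (j : Fin (p + 1)) (e : ℤ) : KosModule 3 4 (p + 1) e →ₗ[ℂ] RR (p + 1) :=
  TensorProduct.lift ((LinearMap.mul ℂ (RR (p + 1))).compl₁₂ (dl id)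
    ((ev j).toLinearMap ∘ₗ (Sdeg 3 e).subtype))

lemma Ph_tmul {p : ℕ} (j : Fin (p + 1)) (ω : ↥(⋀[ℂ]^p ↥(Sdeg 3 4))) (f : PolyC 3) :
    Ph j (ω ⊗ₜ[ℂ] f) = dl j.succAbove ω * ev j f := rfl

lemma Ps_tmul {p : ℕ} (j : Fin (p + 1)) (e : ℤ) (ω : ↥(⋀[ℂ]^(p + 1) ↥(Sdeg 3 4))) (f : Sdeg 3 e) :
    Ps j e (ω ⊗ₜ[ℂ] f) = dl id ω * ev j (f : PolyC 3) := rfl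

lemma laplace {p : ℕ} {e e' : ℤ}
    (D : KosModule 3 4 (p + 1) e →ₗ[ℂ] KosModule 3 4 p e') (hD : IsKoszulDiff 3 4 e e' p D)
    (j : Fin (p + 1)) (x : KosModule 3 4 (p + 1) e) :
    Ps j e x = ((-1 : ℂ) ^ ((j : ℕ) + 1)) • Ph j (TensorProduct.map
      (LinearMap.id (R := ℂ) (M := ↥(⋀[ℂ]^p ↥(Sdeg 3 4)))) (Sdeg 3 e').subtype (D x)) := by
  suffices h : Ps j e = ((-1 : ℂ) ^ ((j : ℕ) + 1)) • (Ph j ∘ₗ (TensorProduct.map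
      (LinearMap.id (R := ℂ) (M := ↥(⋀[ℂ]^p ↥(Sdeg 3 4)))) (Sdeg 3 e').subtype) ∘ₗ D) from
    LinearMap.congr_fun h x
  apply (kB (p + 1) e).ext
  rintro ⟨s, τ⟩
  rw [LinearMap.smul_apply, LinearMap.comp_apply, LinearMap.comp_apply, kB_apply, hD, map_sum,
    Ps_tmul, dl_wedge, Matrix.det_succ_column _ j, Finset.sum_mul, Finset.smul_sum]
  apply Finset.sum_congr rfl
  intro k _
  rw [map_smul, Ph_tmul, dl_wedge, map_mul, smul_smul, ← pow_add, Algebra.smul_def, map_pow, map_neg, map_one]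
  have h1 : ((-1 : RR (p + 1)) ^ ((j : ℕ) + 1 + ((k : ℕ) + 1))) = (-1) ^ ((k : ℕ) + j) := by
    rw [show (j : ℕ) + 1 + ((k : ℕ) + 1) = (k + j) + 2 by ring, pow_add]; simp
  rw [h1]
  simp only [Matrix.submatrix, Matrix.of_apply, id]
  ring

/-- Components along the three variables. -/
noncomputable def Fi (p : ℕ) (i : Fin 3) : KosModule 3 4 p 1 →ₗ[ℂ] RR p :=
  TensorProduct.lift ((LinearMap.mul ℂ (RR p)).compl₁₂ (dl id)
    ((Algebra.linearMap ℂ (RR p)) ∘ₗ (MvPolynomial.lcoeff ℂ (Finsupp.single i 1)) ∘ₗ (Sdeg 3 1).subtype))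

lemma Fi_tmul (p : ℕ) (i : Fin 3) (ω : ↥(⋀[ℂ]^p ↥(Sdeg 3 4))) (f : Sdeg 3 1) :
    Fi p i (ω ⊗ₜ[ℂ] f) = dl id ω * MvPolynomial.C (MvPolynomial.coeff (Finsupp.single i 1) (f : PolyC 3)) := rfl

lemma EX_one (τ : EX 1) : ∃ i, τ.1 = Finsupp.single i 1 := by
  have h := τ.2
  rw [deg3] at h
  by_cases h0 : τ.1 0 = 0
  · by_cases h1 : τ.1 1 = 0
    · refine ⟨2, ?_⟩
      ext i; fin_cases i <;> simp <;> omega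
    · refine ⟨1, ?_⟩
      ext i; fin_cases i <;> simp <;> omega
  · refine ⟨0, ?_⟩
    ext i; fin_cases i <;> simp <;> omega

lemma Ps_eq {p : ℕ} (j : Fin (p + 1)) (x : KosModule 3 4 (p + 1) 1) :
    Ps j 1 x = ∑ i, MvPolynomial.X (j, i) * Fi (p + 1) i x := by
  suffices h : Ps j 1 = ∑ i, (LinearMap.mulLeft ℂ (MvPolynomial.X (j, i))) ∘ₗ Fi (p + 1) i by
    rw [h, LinearMap.sum_apply]; rfl
  apply (kB (p + 1) 1).ext
  rintro ⟨s, τ⟩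
  rw [LinearMap.sum_apply, kB_apply, Ps_tmul]
  obtain ⟨i0, hi⟩ := EX_one τ
  simp only [LinearMap.comp_apply, LinearMap.mulLeft_apply, Fi_tmul, sMono_val, hi, monoC,
    MvPolynomial.coeff_monomial]
  rw [Finset.sum_eq_single i0]
  · rw [if_pos rfl, ev, MvPolynomial.rename_monomial, Finsupp.mapDomain_single, MvPolynomial.C_1, mul_one, mul_comm]
    rfl
  · intro b _ hb
    rw [if_neg, map_zero, mul_zero, mul_zero]
    intro h
    exact hb ((Finsupp.single_left_injective one_ne_zero) h).symm
  · simp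

lemma Fi_zero {p : ℕ} (hp : 3 ≤ p + 1) (x : KosModule 3 4 (p + 1) 1) (h : ∀ j, Ps j 1 x = 0) (i : Fin 3) :
    Fi (p + 1) i x = 0 := by
  let c : Fin 3 → Fin (p + 1) := Fin.castLE hp
  have hc : Function.Injective c := Fin.castLE_injective hp
  let g : MvPolynomial (Fin 3 × Fin 3) ℂ →ₐ[ℂ] RR (p + 1) := MvPolynomial.rename (fun a => (c a.1, a.2))
  have hg : Function.Injective g := by
    apply MvPolynomial.rename_injective
    rintro ⟨a, b⟩ ⟨a', b'⟩ hab
    obtain ⟨h1, h2⟩ := Prod.mk.inj hab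
    exact Prod.ext (hc h1) h2
  let M : Matrix (Fin 3) (Fin 3) (RR (p + 1)) := g.mapMatrix (Matrix.mvPolynomialX (Fin 3) (Fin 3) ℂ)
  have hM : M.det ≠ 0 := by
    rw [← AlgHom.map_det]
    intro h0
    apply Matrix.det_mvPolynomialX_ne_zero (Fin 3) ℂ
    apply hg
    rw [h0, map_zero]
  have hv : M.mulVec (fun i => Fi (p + 1) i x) = 0 := by
    funext j
    rw [Pi.zero_apply, ← h (c j), Ps_eq]
    simp [Matrix.mulVec, dotProduct, M, g]
  exact congrFun (Matrix.eq_zero_of_mulVec_eq_zero hM hv) i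

/-- The exponent of the diagonal term. -/
noncomputable def dE {p : ℕ} (t : Fin p → Ex) : (Fin p × Fin 3) →₀ ℕ :=
  ∑ j, (t j).mapDomain (fun i => (j, i))

lemma dE_apply {p : ℕ} (t : Fin p → Ex) (j : Fin p) (i : Fin 3) : dE t (j, i) = t j i := by
  unfold dE
  rw [Finsupp.finsetSum_apply, Finset.sum_eq_single j]
  · exact Finsupp.mapDomain_apply (fun a b h => (Prod.mk.inj h).2) _ _
  · intro b _ hb
    apply Finsupp.mapDomain_notin_range
    rintro ⟨a, ha⟩
    exact hb (Prod.mk.inj ha).1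
  · simp

lemma dE_inj {p : ℕ} : Function.Injective (dE (p := p)) := by
  intro t t' h
  funext j
  ext i
  rw [← dE_apply, h, dE_apply]

lemma coeff_dl {p : ℕ} (t : Set.powersetCard JJ p) (ω : ↥(⋀[ℂ]^p ↥(Sdeg 3 4))) :
    MvPolynomial.coeff (dE (fun j => ww (oo t j))) (dl id ω) = (vB.exteriorPower p).repr ω t := by
  rw [exteriorPower.basis_repr_apply]
  suffices h : (MvPolynomial.lcoeff ℂ (dE (fun j => ww (oo t j)))) ∘ₗ dl id =
      exteriorPower.ιMultiDual ℂ p vB t from LinearMap.congr_fun h ω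
  apply (vB.exteriorPower p).ext
  intro s
  rw [exteriorPower.basis_apply, exteriorPower.ιMulti_family, exteriorPower.ιMultiDual_apply_ιMulti,
    LinearMap.comp_apply]
  have h1 : dl id (exteriorPower.ιMulti ℂ p (vB ∘ Set.powersetCard.ofFinEmbEquiv.symm s)) =
      Matrix.det (Matrix.of fun i j => ev (id j) (vB (oo s i) : PolyC 3)) := dl_wedge id _
  rw [h1, Matrix.det_apply, Matrix.det_apply, map_sum]
  apply Finset.sum_congr rfl
  intro σ _
  rw [Units.smul_def, Units.smul_def, map_zsmul]
  congr 1
  simp only [Matrix.of_apply, vB_val, id, ev, monoC, MvPolynomial.rename_monomial]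
  rw [← MvPolynomial.monomial_sum_one]
  change MvPolynomial.coeff _ (MvPolynomial.monomial (dE (fun i => ww (oo s (σ i)))) 1) =
    ∏ i, (vB.repr (vB (oo s (σ i)))) (oo t i)
  rw [MvPolynomial.coeff_monomial]
  simp only [Module.Basis.repr_self, Finsupp.single_apply]
  split_ifs with h
  · symm
    apply Finset.prod_eq_one
    intro i _
    rw [if_pos]
    exact ww_inj (congrFun (dE_inj h) i)
  · have : ∃ i, oo s (σ i) ≠ oo t i := by
      by_contra hcon
      push Not at hcon
      apply h
      simp only [hcon]
    obtain ⟨i, hi⟩ := this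
    symm
    apply Finset.prod_eq_zero (Finset.mem_univ i)
    rw [if_neg hi]

lemma sB_repr (e : ℤ) (f : Sdeg 3 e) (τ : EX e) :
    (sB e).repr f τ = MvPolynomial.coeff τ.1 (f : PolyC 3) := by
  suffices h : (sB e).coord τ = (MvPolynomial.lcoeff ℂ τ.1) ∘ₗ (Sdeg 3 e).subtype from
    LinearMap.congr_fun h f
  apply (sB e).ext
  intro σ
  rw [Module.Basis.coord_apply, Module.Basis.repr_self, sB_apply]
  change _ = MvPolynomial.coeff τ.1 (MvPolynomial.monomial σ.1 1)
  rw [MvPolynomial.coeff_monomial, Finsupp.single_apply]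
  simp only [Subtype.ext_iff]

lemma coeff_Fi {p : ℕ} (s : Set.powersetCard JJ p) (τ : EX 1) (i : Fin 3) (hi : τ.1 = Finsupp.single i 1)
    (x : KosModule 3 4 p 1) :
    (kB p 1).repr x (s, τ) = MvPolynomial.coeff (dE (fun j => ww (oo s j))) (Fi p i x) := by
  suffices h : (kB p 1).coord (s, τ) = (MvPolynomial.lcoeff ℂ (dE (fun j => ww (oo s j)))) ∘ₗ Fi p i from
    LinearMap.congr_fun h x
  apply TensorProduct.ext'
  intro ω f
  rw [Module.Basis.coord_apply, LinearMap.comp_apply, Fi_tmul, kB,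
    Module.Basis.tensorProduct_repr_tmul_apply, sB_repr, hi]
  change _ = MvPolynomial.coeff _ _
  rw [mul_comm, MvPolynomial.coeff_C_mul, coeff_dl, smul_eq_mul]

/-- Injectivity. -/
lemma ker_bot {p : ℕ} (hp : 3 ≤ p + 1) {e' : ℤ}
    (D : KosModule 3 4 (p + 1) 1 →ₗ[ℂ] KosModule 3 4 p e') (hD : IsKoszulDiff 3 4 1 e' p D) :
    LinearMap.ker D = ⊥ := by
  rw [eq_bot_iff]
  intro x hx
  rw [LinearMap.mem_ker] at hx
  have h1 : ∀ j, Ps j 1 x = 0 := by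
    intro j
    rw [laplace D hD j x, hx, map_zero, map_zero, smul_zero]
  have h2 := Fi_zero hp x h1
  rw [Submodule.mem_bot]
  apply (kB (p + 1) 1).repr.injective
  rw [map_zero]
  ext ⟨s, τ⟩
  obtain ⟨i, hi⟩ := EX_one τ
  rw [coeff_Fi s τ i hi x, h2, MvPolynomial.coeff_zero, Finsupp.zero_apply]

end VB

/-! ### Part F: the Betti numbers -/

namespace VB

lemma cdim_eq (M : Type*) [AddCommMonoid M] [Module ℂ M] : cdim M = Module.finrank ℂ M := rfl

/-- Rank of the differential into position `(p, q)`. -/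
noncomputable def rr (D : KFam 3 4) (p : ℕ) (q : ℤ) : ℕ :=
  Module.finrank ℂ (LinearMap.range (D p (1 + (q - 1) * 4) (1 + q * 4)))

lemma kd_zero (D : KFam 3 4) (q : ℤ) :
    Kdim 3 4 D 1 0 q + rr D 0 q = Fintype.card (EX (1 + q * 4)) := by
  have h1 := Submodule.finrank_le (LinearMap.range (D 0 (1 + (q - 1) * 4) (1 + q * 4)))
  have h2 := finrank_Kos 0 (1 + q * 4)
  rw [Nat.choose_zero_right, one_mul] at h2
  rw [Kdim, cdim_eq, cdim_eq, rr, Nat.sub_add_cancel h1, h2]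

lemma gen_mono {V : Type} [AddCommGroup V] [Module ℂ V] [Module.Finite ℂ V] (s t : Submodule ℂ V)
    (h : s ≤ t) : Module.finrank ℂ s ≤ Module.finrank ℂ t := Submodule.finrank_mono h

lemma gen_rn {V W : Type} [AddCommGroup V] [Module ℂ V] [Module.Finite ℂ V] [AddCommGroup W]
    [Module ℂ W] (f : V →ₗ[ℂ] W) :
    Module.finrank ℂ (LinearMap.range f) + Module.finrank ℂ (LinearMap.ker f) =
      Module.finrank ℂ V := LinearMap.finrank_range_add_finrank_ker f

lemma kd_succ (D : KFam 3 4) (hD : IsKoszulFam 3 4 D) (p : ℕ) (q : ℤ) :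
    Kdim 3 4 D 1 (p + 1) q + rr D (p + 1) q + rr D p (q + 1) =
      (15).choose (p + 1) * Fintype.card (EX (1 + q * 4)) := by
  have hle : LinearMap.range (D (p + 1) (1 + (q - 1) * 4) (1 + q * 4)) ≤
      LinearMap.ker (D p (1 + q * 4) (1 + (q + 1) * 4)) :=
    D_D (by ring) (by ring) _ (hD _ _ _ (by ring)) _ (hD _ _ _ (by ring))
  have h1 := gen_mono (V := KosModule 3 4 (p + 1) (1 + q * 4)) _ _ hle
  have h2 := gen_rn (V := KosModule 3 4 (p + 1) (1 + q * 4))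
    (W := KosModule 3 4 p (1 + (q + 1) * 4)) (D p (1 + q * 4) (1 + (q + 1) * 4))
  rw [finrank_Kos] at h2
  have h3 : rr D p (q + 1) =
      Module.finrank ℂ (LinearMap.range (D p (1 + q * 4) (1 + (q + 1) * 4))) := by
    unfold rr
    rw [add_sub_cancel_right]
  rw [Kdim, cdim_eq, cdim_eq, inf_eq_left.mpr hle, h3, rr, Nat.sub_add_cancel h1, ← h2, add_comm]

lemma K_zero_of (D : KFam 3 4) (hD : IsKoszulFam 3 4 D) (p : ℕ) (q : ℤ)
    (h : ∀ t ∈ Sup (gr JJ (p + 1) (1 + q * 4)), dT ww t = 0 →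
      ∃ s ∈ Sup (gr JJ (p + 1 + 1) (1 + (q - 1) * 4)), dT ww s = t) : Kdim 3 4 D 1 (p + 1) q = 0 := by
  have hle : LinearMap.ker (D p (1 + q * 4) (1 + (q + 1) * 4)) ≤
      LinearMap.range (D (p + 1) (1 + (q - 1) * 4) (1 + q * 4)) := by
    intro x hx
    exact transfer (by ring) _ (hD _ _ _ (by ring)) _
      (h _ (io_mem x) (io_ker (by ring) _ (hD _ _ _ (by ring)) x hx))
  rw [Kdim, inf_eq_right.mpr hle, Nat.sub_self]

lemma K_zero_of0 (D : KFam 3 4) (hD : IsKoszulFam 3 4 D) (q : ℤ) (hq : 1 ≤ q) :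
    Kdim 3 4 D 1 0 q = 0 := by
  have hle : LinearMap.range (D 0 (1 + (q - 1) * 4) (1 + q * 4)) = ⊤ := by
    rw [eq_top_iff]
    intro x _
    exact transfer (by ring) _ (hD _ _ _ (by ring)) _
      (exact_0 (by ring) (by omega) _ (io_mem x))
  rw [Kdim, hle, cdim_eq, cdim_eq, finrank_top, Nat.sub_self]

lemma K_neg (D : KFam 3 4) (hD : IsKoszulFam 3 4 D) (p : ℕ) (q : ℤ) (hq : q < 0) :
    Kdim 3 4 D 1 p q = 0 := by
  haveI := EX_neg (show 1 + q * 4 < 0 by omega)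
  have hc : Fintype.card (EX (1 + q * 4)) = 0 := Fintype.card_eq_zero
  cases p with
  | zero => have := kd_zero D q; omega
  | succ p => have := kd_succ D hD p q; rw [hc, mul_zero] at this; omega

lemma vanish (D : KFam 3 4) (hD : IsKoszulFam 3 4 D) (p : ℕ) (q : ℤ)
    (h : ¬((p ≤ 2 ∧ q = 0) ∨ (2 ≤ p ∧ p ≤ 11 ∧ q = 1) ∨ (p = 12 ∧ q = 2))) :
    Kdim 3 4 D 1 p q = 0 := by
  rcases lt_or_ge q 0 with hq | hq
  · exact K_neg D hD p q hq
  cases p with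
  | zero => exact K_zero_of0 D hD q (by omega)
  | succ p =>
    by_cases h0 : q = 0
    · subst h0
      have hk : LinearMap.ker (D p (1 + 0 * 4) (1 + (0 + 1) * 4)) = ⊥ :=
        ker_bot (by omega) _ (hD _ _ _ (by ring))
      rw [Kdim, hk, cdim_eq, cdim_eq, inf_bot_eq, Nat.sub_self]
    refine K_zero_of D hD p q fun t ht hdt => ?_
    by_cases hp : 13 ≤ p + 1
    · exact exact_13 (by ring) hp t ht hdt
    by_cases h1 : q = 1
    · subst h1
      by_cases hp0 : p = 0
      · subst hp0
        exact exact_1_5 t ht hdt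
      · have hp11 : p = 11 := by omega
        subst hp11
        exact exact_12_5 (by ring) (by norm_num) t ht hdt
    by_cases h2 : q = 2
    · subst h2
      exact exact_9 (by ring) (by norm_num) (by omega) t ht hdt
    · exact exact_hi (by ring) (by omega) t ht hdt

lemma cardE (q : ℕ) : Fintype.card (EX (1 + (q : ℤ) * 4)) = (4 * q + 3).choose 2 := by
  have h : (1 + (q : ℤ) * 4) = ((4 * q + 1 : ℕ) : ℤ) := by push_cast; ring
  rw [h, card_EX]

/-- The expected ranks. -/
def RK : ℕ → ℕ → ℤ
  | 0, q => (4 * q + 3).choose 2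
  | p + 1, q => (15).choose (p + 1) * (4 * q + 3).choose 2 - RK p (q + 1)

lemma rr_eq (D : KFam 3 4) (hD : IsKoszulFam 3 4 D) (p : ℕ) : ∀ q : ℕ, p ≤ 11 → 2 ≤ q →
    (rr D p q : ℤ) = RK p q := by
  induction p with
  | zero =>
    intro q _ hq
    have h1 := kd_zero D q
    rw [vanish D hD 0 q (by omega), cardE] at h1
    rw [RK]
    omega
  | succ p ih =>
    intro q hp hq
    have h1 := kd_succ D hD p q
    rw [vanish D hD (p + 1) q (by omega), cardE] at h1
    have h2 := ih (q + 1) (by omega) (by omega)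
    push_cast at h2
    rw [RK, ← h2]
    have h3 := congrArg (Nat.cast : ℕ → ℤ) h1
    push_cast at h3
    linarith

lemma rr_neg (D : KFam 3 4) (p : ℕ) : rr D p 0 = 0 := by
  haveI := EX_neg (show 1 + ((0 : ℤ) - 1) * 4 < 0 by norm_num)
  have hc : Fintype.card (EX (1 + ((0 : ℤ) - 1) * 4)) = 0 := Fintype.card_eq_zero
  have h1 := finrank_Kos (p + 1) (1 + ((0 : ℤ) - 1) * 4)
  rw [hc, mul_zero] at h1
  have h2 := LinearMap.finrank_range_le (D p (1 + ((0 : ℤ) - 1) * 4) (1 + 0 * 4))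
  unfold rr
  omega

lemma e0 (D : KFam 3 4) (hD : IsKoszulFam 3 4 D) (p : ℕ) :
    Kdim 3 4 D 1 (p + 1) 0 + rr D p 1 = (15).choose (p + 1) * 3 := by
  have h := kd_succ D hD p 0
  have hc := cardE 0
  simp only [Nat.cast_zero] at hc
  rw [rr_neg, hc, add_zero, zero_add] at h
  exact h

lemma e1 (D : KFam 3 4) (hD : IsKoszulFam 3 4 D) (p : ℕ) :
    Kdim 3 4 D 1 (p + 1) 1 + rr D (p + 1) 1 + rr D p 2 = (15).choose (p + 1) * 21 := by
  have h := kd_succ D hD p 1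
  have hc := cardE 1
  simp only [Nat.cast_one] at hc
  rw [hc] at h
  exact h

lemma e2 (D : KFam 3 4) (hD : IsKoszulFam 3 4 D) (p : ℕ) :
    Kdim 3 4 D 1 (p + 1) 2 + rr D (p + 1) 2 + rr D p (2 + 1) = (15).choose (p + 1) * 55 := by
  have h := kd_succ D hD p 2
  have hc : Fintype.card (EX (1 + (2 : ℤ) * 4)) = 55 := cardE 2
  rw [hc] at h
  exact h

lemma K1 (D : KFam 3 4) (hD : IsKoszulFam 3 4 D) (p : ℕ) (h2 : 1 ≤ p) (hp : p ≤ 11) :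
    (Kdim 3 4 D 1 (p + 1) 1 : ℤ) = (15).choose (p + 1) * 21 - (15).choose (p + 2) * 3 - RK p 2 := by
  have h1 := e1 D hD p
  have h0 := e0 D hD (p + 1)
  rw [vanish D hD (p + 1 + 1) 0 (by omega), zero_add] at h0
  have h3 := rr_eq D hD p 2 hp le_rfl
  rw [← h3]
  have h4 := congrArg (Nat.cast : ℕ → ℤ) h1
  have h5 := congrArg (Nat.cast : ℕ → ℤ) h0
  push_cast at h4 h5 ⊢
  linarith

lemma K00 (D : KFam 3 4) : Kdim 3 4 D 1 0 0 = 3 := by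
  have h := kd_zero D 0
  have hc := cardE 0
  simp only [Nat.cast_zero] at hc
  rw [rr_neg, hc, add_zero] at h
  exact h

lemma r01 (D : KFam 3 4) (hD : IsKoszulFam 3 4 D) : rr D 0 1 = 21 := by
  have h := kd_zero D 1
  have hc := cardE 1
  simp only [Nat.cast_one] at hc
  rw [vanish D hD 0 1 (by omega), hc, zero_add] at h
  exact h

lemma K10 (D : KFam 3 4) (hD : IsKoszulFam 3 4 D) : Kdim 3 4 D 1 1 0 = 24 := by
  have h := e0 D hD 0
  rw [r01 D hD] at h
  norm_num at h
  omega

lemma K20 (D : KFam 3 4) (hD : IsKoszulFam 3 4 D) : Kdim 3 4 D 1 2 0 = 55 := by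
  have h := e0 D hD 1
  have h1 := e1 D hD 0
  have h2 := rr_eq D hD 0 2 (by omega) le_rfl
  rw [vanish D hD (0 + 1) 1 (by omega)] at h1
  have h3 : RK 0 2 = 55 := by decide
  have h4 : (15).choose 2 = 105 := by decide
  rw [h3] at h2
  norm_num [h4] at h h1 h2
  omega

lemma K122 (D : KFam 3 4) (hD : IsKoszulFam 3 4 D) : Kdim 3 4 D 1 12 2 = 1 := by
  have h : Kdim 3 4 D 1 12 2 + rr D 12 2 + rr D 11 (2 + 1) = (15).choose 12 * 55 := e2 D hD 11
  have h1 := e1 D hD 12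
  rw [vanish D hD (12 + 1) 1 (by omega)] at h1
  have h0 := e0 D hD 13
  rw [vanish D hD (13 + 1) 0 (by omega)] at h0
  have h2 := rr_eq D hD 11 3 le_rfl (by omega)
  have h3 : RK 11 3 = 22864 := by decide +kernel
  have c1 : (15).choose 12 = 455 := by decide +kernel
  have c2 : (15).choose 13 = 105 := by decide +kernel
  have c3 : (15).choose 14 = 15 := by decide +kernel
  rw [h3] at h2
  have h2' : rr D 11 (2 + 1) = 22864 := by exact_mod_cast h2
  change 0 + rr D 13 1 + rr D 12 2 = (15).choose 13 * 21 at h1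
  change 0 + rr D 13 1 = (15).choose 14 * 3 at h0
  rw [c1] at h
  rw [c2] at h1
  rw [c3] at h0
  omega

end VB


/-- Betti table of the pushforward of O(b=1) under the 4-uple Veronese embedding of P^2. -/
theorem veronese_betti_P2_b1_d4 (D : KFam 3 4) (hD : IsKoszulFam 3 4 D) :
    Kdim 3 4 D 1 0 0 = 3 ∧
    Kdim 3 4 D 1 1 0 = 24 ∧
    Kdim 3 4 D 1 2 0 = 55 ∧
    Kdim 3 4 D 1 2 1 = 120 ∧
    Kdim 3 4 D 1 3 1 = 1089 ∧
    Kdim 3 4 D 1 4 1 = 3344 ∧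
    Kdim 3 4 D 1 5 1 = 6237 ∧
    Kdim 3 4 D 1 6 1 = 7920 ∧
    Kdim 3 4 D 1 7 1 = 7095 ∧
    Kdim 3 4 D 1 8 1 = 4488 ∧
    Kdim 3 4 D 1 9 1 = 1947 ∧
    Kdim 3 4 D 1 10 1 = 536 ∧
    Kdim 3 4 D 1 11 1 = 75 ∧
    Kdim 3 4 D 1 12 2 = 1 ∧
    (∀ (p : ℕ) (q : ℤ), ¬((p ≤ 2 ∧ q = 0) ∨ (2 ≤ p ∧ p ≤ 11 ∧ q = 1) ∨ (p = 12 ∧ q = 2)) →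
      Kdim 3 4 D 1 p q = 0) := by
  have k1 : ∀ (p : ℕ) (n : ℕ), 1 ≤ p → p ≤ 10 →
      ((15).choose (p + 1) * 21 - (15).choose (p + 2) * 3 - VB.RK p 2 : ℤ) = n →
      Kdim 3 4 D 1 (p + 1) 1 = n := by
    intro p n h1 h2 h3
    have := VB.K1 D hD p h1 (by omega)
    rw [h3] at this
    exact_mod_cast this
  refine ⟨VB.K00 D, VB.K10 D hD, VB.K20 D hD, ?_, ?_, ?_, ?_, ?_, ?_, ?_, ?_, ?_, ?_,
    VB.K122 D hD, VB.vanish D hD⟩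
  · exact k1 1 _ (by norm_num) (by norm_num) (by decide +kernel)
  · exact k1 2 _ (by norm_num) (by norm_num) (by decide +kernel)
  · exact k1 3 _ (by norm_num) (by norm_num) (by decide +kernel)
  · exact k1 4 _ (by norm_num) (by norm_num) (by decide +kernel)
  · exact k1 5 _ (by norm_num) (by norm_num) (by decide +kernel)
  · exact k1 6 _ (by norm_num) (by norm_num) (by decide +kernel)
  · exact k1 7 _ (by norm_num) (by norm_num) (by decide +kernel)
  · exact k1 8 _ (by norm_num) (by norm_num) (by decide +kernel)
  · exact k1 9 _ (by norm_num) (by norm_num) (by decide +kernel)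
  · exact k1 10 _ (by norm_num) (by norm_num) (by decide +kernel)
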